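/- (One-step consensus distance recursion.) Let n, d ≥ 1, p ∈ (0,1], γ ≥ 0, σ ≥ 0, let W be a mixing matrix with parameter p, and let f_1, …, f_n : ℝ^d → ℝ be differentiable. Fix points x_1, …, x_n ∈ ℝ^d, let X ∈ ℝ^{d×n} have columns x_i, and set Ξ² = (1/n)‖X − X̄‖_F² and φ² = (1/n)∑_{i=1}^n ‖∇f_i(x_i)‖². Let g_1, …, g_n : Ω → ℝ^d be square-integrable random vectors on a probability space with E[g_i] = ∇f_i(x_i) and E‖g_i − ∇f_i(x_i)‖² ≤ σ² for each i, let G be the random matrix with columns g_i, and let X⁺ = (X − γG)W with columnwise mean x̄⁺. Then E[(1/n)·∑_{i=1}^n ‖x̄⁺ − x⁺_i‖²] ≤ (1 − p/2)·Ξ² + (3(1−p)γ²/p)·(φ² + pσ²). -/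

import Mathlib

open scoped BigOperators

/-- Frobenius norm of a real matrix. -/
noncomputable def frob {d n : ℕ} (X : Matrix (Fin d) (Fin n) ℝ) : ℝ :=
  Real.sqrt (∑ i, ∑ j, (X i j) ^ 2)

/-- The matrix `X̄` all of whose columns equal the column-wise mean `x̄ = (1/n) ∑ᵢ xᵢ` of `X`. -/
noncomputable def colMeanMat {d n : ℕ} (X : Matrix (Fin d) (Fin n) ℝ) :
    Matrix (Fin d) (Fin n) ℝ :=
  Matrix.of fun i _ => (1 / (n : ℝ)) * ∑ j, X i j

/-- A doubly stochastic matrix: nonnegative entries with all row sums and column sums one. -/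
def DoublyStochastic {n : ℕ} (W : Matrix (Fin n) (Fin n) ℝ) : Prop :=
  (∀ i j, 0 ≤ W i j) ∧ (∀ i, ∑ j, W i j = 1) ∧ (∀ j, ∑ i, W i j = 1)

/-- `W` is a mixing matrix with parameter `p`: it is doubly stochastic and
`‖XW − X̄‖_F² ≤ (1−p)·‖X − X̄‖_F²` for every `d` and `X ∈ ℝ^{d×n}`. -/
def IsMixing {n : ℕ} (W : Matrix (Fin n) (Fin n) ℝ) (p : ℝ) : Prop :=
  DoublyStochastic W ∧ ∀ (d : ℕ) (X : Matrix (Fin d) (Fin n) ℝ),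
    (frob (X * W - colMeanMat X)) ^ 2 ≤ (1 - p) * (frob (X - colMeanMat X)) ^ 2


open MeasureTheory

/-- The `j`-th column of a matrix `X ∈ ℝ^{d×n}`, viewed as a vector of the Euclidean space
`ℝ^d`. -/
noncomputable def col {d n : ℕ} (X : Matrix (Fin d) (Fin n) ℝ) (j : Fin n) :
    EuclideanSpace ℝ (Fin d) :=
  (WithLp.equiv 2 (Fin d → ℝ)).symm (fun i => X i j)

lemma frob_sq {d n : ℕ} (X : Matrix (Fin d) (Fin n) ℝ) :
    frob X ^ 2 = ∑ i, ∑ j, X i j ^ 2 :=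
  Real.sq_sqrt (by positivity)

lemma colMeanMat_mul {d n : ℕ} (X : Matrix (Fin d) (Fin n) ℝ) {W : Matrix (Fin n) (Fin n) ℝ}
    (hW : ∀ i, ∑ j, W i j = 1) : colMeanMat (X * W) = colMeanMat X := by
  ext i j
  simp only [colMeanMat, Matrix.of_apply, Matrix.mul_apply]
  rw [Finset.sum_comm]
  simp [← Finset.mul_sum, hW]

lemma sum_sub_mean {n : ℕ} (hn : (n : ℝ) ≠ 0) (v : Fin n → ℝ) :
    ∑ j, (v j - 1 / (n : ℝ) * ∑ k, v k) = 0 := by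
  simp [Finset.sum_sub_distrib, hn]

/-- Centring a finite family does not increase its sum of squares. -/
lemma sum_sub_mean_sq_le {n : ℕ} (hn : (n : ℝ) ≠ 0) (v : Fin n → ℝ) :
    ∑ j, (v j - 1 / (n : ℝ) * ∑ k, v k) ^ 2 ≤ ∑ j, v j ^ 2 := by
  set c := 1 / (n : ℝ) * ∑ k, v k with hc
  have hsum : ∑ j, (v j - c) = 0 := sum_sub_mean hn v
  have hsplit : ∑ j, v j ^ 2 = ∑ j, (v j - c) ^ 2 + 2 * c * ∑ j, (v j - c) + n * c ^ 2 := by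
    calc ∑ j, v j ^ 2 = ∑ j, ((v j - c) ^ 2 + 2 * c * (v j - c) + c ^ 2) :=
          Finset.sum_congr rfl fun j _ => by ring
      _ = _ := by rw [Finset.sum_add_distrib, Finset.sum_add_distrib, ← Finset.mul_sum]; simp
  rw [hsplit, hsum]
  have : 0 ≤ (n : ℝ) * c ^ 2 := by positivity
  linarith

/-- Young's inequality for the square of a difference. -/
lemma sub_sq_le_young {p : ℝ} (hp : 0 < p) (a b : ℝ) :
    (a - b) ^ 2 ≤ (1 + p / 2) * a ^ 2 + (1 + 2 / p) * b ^ 2 := by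
  have h : 0 ≤ (p * a + 2 * b) ^ 2 / (2 * p) := by positivity
  have h' : (p * a + 2 * b) ^ 2 / (2 * p)
      = (1 + p / 2) * a ^ 2 + (1 + 2 / p) * b ^ 2 - (a - b) ^ 2 := by
    field_simp
    ring
  linarith

/-- Deviation from the mean of a perturbed gradient step, for a single coordinate: `x` are the
iterates, `m` the gradients and `v` the noise. The noise enters linearly and quadratically only. -/
lemma sum_sub_mean_step_le {n : ℕ} (hn : (n : ℝ) ≠ 0) {p : ℝ} (hp : 0 < p) (γ : ℝ)
    (x m v : Fin n → ℝ) :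
    ∑ j, (x j - γ * (m j + v j) - 1 / (n : ℝ) * ∑ k, (x k - γ * (m k + v k))) ^ 2
      ≤ (1 + p / 2) * ∑ j, (x j - 1 / (n : ℝ) * ∑ k, x k) ^ 2
        + (1 + 2 / p) * γ ^ 2 * ∑ j, m j ^ 2
        - 2 * γ * ∑ j, (x j - γ * m j - 1 / (n : ℝ) * ∑ k, (x k - γ * m k)) * v j
        + γ ^ 2 * ∑ j, v j ^ 2 := by
  set u : Fin n → ℝ := fun j => x j - γ * m j - 1 / (n : ℝ) * ∑ k, (x k - γ * m k) with hu
  set c := 1 / (n : ℝ) * ∑ k, v k with hc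
  have hu0 : ∑ j, u j = 0 := sum_sub_mean hn fun j => x j - γ * m j
  have hexp : ∑ j, (x j - γ * (m j + v j) - 1 / (n : ℝ) * ∑ k, (x k - γ * (m k + v k))) ^ 2
      = ∑ j, u j ^ 2 - 2 * γ * ∑ j, u j * v j + 2 * γ * c * ∑ j, u j
        + γ ^ 2 * ∑ j, (v j - c) ^ 2 := by
    simp only [Finset.mul_sum, ← Finset.sum_add_distrib, ← Finset.sum_sub_distrib]
    refine Finset.sum_congr rfl fun j _ => ?_
    have h : ∑ k, 1 / (n : ℝ) * (x k - γ * (m k + v k))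
        = 1 / (n : ℝ) * ∑ k, (x k - γ * m k) - γ * c := by
      simp only [hc, Finset.mul_sum, ← Finset.sum_sub_distrib]
      exact Finset.sum_congr rfl fun k _ => by ring
    rw [h]
    simp only [hu]
    ring
  have hyoung : ∑ j, u j ^ 2 ≤ (1 + p / 2) * ∑ j, (x j - 1 / (n : ℝ) * ∑ k, x k) ^ 2
      + (1 + 2 / p) * γ ^ 2 * ∑ j, (m j - 1 / (n : ℝ) * ∑ k, m k) ^ 2 := by
    rw [Finset.mul_sum Finset.univ _ (1 + p / 2),
      Finset.mul_sum Finset.univ _ ((1 + 2 / p) * γ ^ 2), ← Finset.sum_add_distrib]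
    refine Finset.sum_le_sum fun j _ => ?_
    have h := sub_sq_le_young hp (x j - 1 / (n : ℝ) * ∑ k, x k)
      (γ * (m j - 1 / (n : ℝ) * ∑ k, m k))
    have h' : u j = (x j - 1 / (n : ℝ) * ∑ k, x k) - γ * (m j - 1 / (n : ℝ) * ∑ k, m k) := by
      simp only [hu, Finset.sum_sub_distrib, ← Finset.mul_sum]
      ring
    rw [h']
    linarith
  have hm := mul_le_mul_of_nonneg_left (sum_sub_mean_sq_le hn m)
    (by positivity : 0 ≤ (1 + 2 / p) * γ ^ 2)
  have hv := mul_le_mul_of_nonneg_left (sum_sub_mean_sq_le hn v) (sq_nonneg γ)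
  rw [hexp, hu0]
  linarith

/-- Doubly stochastic averaging preserves the mean, so a mixing matrix contracts the consensus
distance. -/
lemma IsMixing.frob_sub_colMeanMat_mul_sq_le {d n : ℕ} {W : Matrix (Fin n) (Fin n) ℝ} {p : ℝ}
    (hW : IsMixing W p) (Y : Matrix (Fin d) (Fin n) ℝ) :
    frob (Y * W - colMeanMat (Y * W)) ^ 2 ≤ (1 - p) * frob (Y - colMeanMat Y) ^ 2 := by
  rw [colMeanMat_mul Y hW.1.2.1]
  exact hW.2 d Y

/-- Matrix form of `sum_sub_mean_step_le`, with gradients and noise given by columns. -/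
lemma frob_step_sq_le {d n : ℕ} (hn : (n : ℝ) ≠ 0) {p : ℝ} (hp : 0 < p) (γ : ℝ)
    (X G : Matrix (Fin d) (Fin n) ℝ) (m g : Fin n → EuclideanSpace ℝ (Fin d))
    (hG : ∀ i j, G i j = g j i) :
    frob (X - γ • G - colMeanMat (X - γ • G)) ^ 2
      ≤ (1 + p / 2) * frob (X - colMeanMat X) ^ 2
        + (1 + 2 / p) * γ ^ 2 * ∑ j, ‖m j‖ ^ 2
        - 2 * γ * ∑ j, inner ℝ (col (X - γ • Matrix.of (fun i j => m j i)
            - colMeanMat (X - γ • Matrix.of (fun i j => m j i))) j) (g j - m j)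
        + γ ^ 2 * ∑ j, ‖g j - m j‖ ^ 2 := by
  have h := Finset.sum_le_sum fun i (_ : i ∈ Finset.univ) =>
    sum_sub_mean_step_le hn hp γ (X i) (fun j => m j i) (fun j => (g j - m j) i)
  simp only [Finset.sum_add_distrib, Finset.sum_sub_distrib, ← Finset.mul_sum] at h
  rw [Finset.sum_comm (f := fun i j => m j i ^ 2),
    Finset.sum_comm (f := fun i j => (g j - m j) i ^ 2),
    Finset.sum_comm (f := fun i j => _ * (g j - m j) i)] at h
  simpa [frob_sq, colMeanMat, hG, EuclideanSpace.real_norm_sq_eq, PiLp.inner_apply, col,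
    Finset.sum_sub_distrib, ← Finset.mul_sum, mul_comm] using h

/-- one-step consensus distance recursion.  With mixing matrix `W` of
parameter `p`, stepsize `γ`, stochastic gradients `gⱼ` that are unbiased estimates of
`∇fⱼ(xⱼ)` with variance at most `σ²`, the gossip update `X⁺ = (X − γG)W` satisfies
`E[(1/n)∑ᵢ‖x̄⁺ − x⁺ᵢ‖²] ≤ (1 − p/2)·Ξ² + (3(1−p)γ²/p)·(φ² + pσ²)`. -/
theorem one_step_consensus_recursion
    {n d : ℕ} (hn : 1 ≤ n) (hd : 1 ≤ d) (p γ σ : ℝ)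
    (hp : 0 < p) (hp1 : p ≤ 1) (hγ : 0 ≤ γ) (hσ : 0 ≤ σ)
    (W : Matrix (Fin n) (Fin n) ℝ) (hW : IsMixing W p)
    (f : Fin n → EuclideanSpace ℝ (Fin d) → ℝ) (hf : ∀ j, Differentiable ℝ (f j))
    (X : Matrix (Fin d) (Fin n) ℝ)
    {Ω : Type*} [MeasureSpace Ω] [IsProbabilityMeasure (volume : Measure Ω)]
    (g : Fin n → Ω → EuclideanSpace ℝ (Fin d))
    (hgint : ∀ j, Integrable (g j))
    (hgsqint : ∀ j, Integrable (fun ω => ‖g j ω - gradient (f j) (col X j)‖ ^ 2))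
    (hgmean : ∀ j, (∫ ω, g j ω) = gradient (f j) (col X j))
    (hgvar : ∀ j, ∫ ω, ‖g j ω - gradient (f j) (col X j)‖ ^ 2 ≤ σ ^ 2)
    (G : Ω → Matrix (Fin d) (Fin n) ℝ)
    (hG : ∀ ω i j, G ω i j = (WithLp.equiv 2 (Fin d → ℝ)) (g j ω) i)
    (Xplus : Ω → Matrix (Fin d) (Fin n) ℝ)
    (hXplus : ∀ ω, Xplus ω = (X - γ • G ω) * W)
    (Ξsq φsq : ℝ)
    (hΞ : Ξsq = (1 / (n : ℝ)) * (frob (X - colMeanMat X)) ^ 2)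
    (hφ : φsq = (1 / (n : ℝ)) * ∑ j, ‖gradient (f j) (col X j)‖ ^ 2) :
    ∫ ω, (1 / (n : ℝ)) * (frob (Xplus ω - colMeanMat (Xplus ω))) ^ 2
      ≤ (1 - p / 2) * Ξsq + (3 * (1 - p) * γ ^ 2 / p) * (φsq + p * σ ^ 2) := by
  have hn0 : (0 : ℝ) < n := by exact_mod_cast hn
  set m : Fin n → EuclideanSpace ℝ (Fin d) := fun j => gradient (f j) (col X j) with hm
  set K : Fin n → EuclideanSpace ℝ (Fin d) := col (X - γ • Matrix.of (fun i j => m j i)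
    - colMeanMat (X - γ • Matrix.of (fun i j => m j i)))
  set D := frob (X - colMeanMat X) ^ 2
  set S := ∑ j, ‖m j‖ ^ 2
  have hD0 : 0 ≤ D := sq_nonneg _
  have hS0 : 0 ≤ S := by positivity
  have hnoise : ∀ j, Integrable (fun ω => g j ω - m j) := fun j =>
    (hgint j).sub (integrable_const _)
  have hlin : ∀ j, Integrable (fun ω => inner ℝ (K j) (g j ω - m j)) := fun j =>
    (hnoise j).const_inner (K j)
  have hlin0 : ∀ j, ∫ ω, inner ℝ (K j) (g j ω - m j) = 0 := fun j => by
    rw [integral_inner (hnoise j), integral_sub (hgint j) (integrable_const _), hgmean j]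
    simp [hm]
  have hsumlin : Integrable (fun ω => ∑ j, inner ℝ (K j) (g j ω - m j)) :=
    integrable_finsetSum _ fun j _ => hlin j
  have hsumsq : Integrable (fun ω => ∑ j, ‖g j ω - m j‖ ^ 2) :=
    integrable_finsetSum _ fun j _ => hgsqint j
  have hvar : ∫ ω, ∑ j, ‖g j ω - m j‖ ^ 2 ≤ n * σ ^ 2 := by
    rw [integral_finsetSum _ fun j _ => hgsqint j]
    simpa using Finset.sum_le_sum fun j (_ : j ∈ Finset.univ) => hgvar j
  set C := (1 + p / 2) * D + (1 + 2 / p) * γ ^ 2 * S with hC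
  set c := 1 / (n : ℝ) * (1 - p) with hc
  have hc0 : 0 ≤ c := mul_nonneg (by positivity) (by linarith)
  have hbound : ∀ ω, 1 / (n : ℝ) * frob (Xplus ω - colMeanMat (Xplus ω)) ^ 2
      ≤ c * (C - 2 * γ * ∑ j, inner ℝ (K j) (g j ω - m j)
        + γ ^ 2 * ∑ j, ‖g j ω - m j‖ ^ 2) := fun ω => by
    rw [hXplus ω, hc, mul_assoc]
    refine mul_le_mul_of_nonneg_left ((hW.frob_sub_colMeanMat_mul_sq_le _).trans ?_)
      (by positivity)
    exact mul_le_mul_of_nonneg_left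
      (frob_step_sq_le hn0.ne' hp γ X (G ω) m (fun j => g j ω) (hG ω)) (by linarith)
  have hdiff : Integrable (fun ω => C - 2 * γ * ∑ j, inner ℝ (K j) (g j ω - m j)) :=
    (integrable_const C).sub (hsumlin.const_mul _)
  have hint : Integrable (fun ω => c * (C - 2 * γ * ∑ j, inner ℝ (K j) (g j ω - m j)
      + γ ^ 2 * ∑ j, ‖g j ω - m j‖ ^ 2)) :=
    (hdiff.add (hsumsq.const_mul _)).const_mul c
  have hexpect : ∫ ω, c * (C - 2 * γ * ∑ j, inner ℝ (K j) (g j ω - m j)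
      + γ ^ 2 * ∑ j, ‖g j ω - m j‖ ^ 2) = c * (C + γ ^ 2 * ∫ ω, ∑ j, ‖g j ω - m j‖ ^ 2) := by
    rw [integral_const_mul, integral_add hdiff (hsumsq.const_mul _),
      integral_sub (integrable_const C) (hsumlin.const_mul _),
      integral_const_mul, integral_const_mul, integral_finsetSum _ fun j _ => hlin j]
    simp [hlin0]
  have hcoefD : (1 - p) * (1 + p / 2) * D ≤ (1 - p / 2) * D :=
    mul_le_mul_of_nonneg_right (by nlinarith) hD0
  have hcoefS : 1 + 2 / p ≤ 3 / p := by
    rw [show (3 : ℝ) / p = 1 / p + 2 / p by ring]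
    gcongr
    exact (one_le_div hp).2 hp1
  calc ∫ ω, 1 / (n : ℝ) * frob (Xplus ω - colMeanMat (Xplus ω)) ^ 2
      ≤ c * (C + γ ^ 2 * ∫ ω, ∑ j, ‖g j ω - m j‖ ^ 2) := by
        rw [← hexpect]
        exact integral_mono_of_nonneg (.of_forall fun ω => by positivity) hint
          (.of_forall hbound)
    _ ≤ c * ((1 + p / 2) * D + 3 / p * γ ^ 2 * S + γ ^ 2 * (3 * (n * σ ^ 2))) := by
        rw [hC]
        gcongr
        nlinarith [mul_nonneg hn0.le (sq_nonneg σ)]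
    _ = 1 / (n : ℝ) * ((1 - p) * (1 + p / 2) * D)
          + 3 * (1 - p) * γ ^ 2 / p * (1 / (n : ℝ) * S + p * σ ^ 2) := by
        rw [hc]
        field_simp
        ring
    _ ≤ 1 / (n : ℝ) * ((1 - p / 2) * D)
          + 3 * (1 - p) * γ ^ 2 / p * (1 / (n : ℝ) * S + p * σ ^ 2) := by gcongr
    _ = (1 - p / 2) * Ξsq + 3 * (1 - p) * γ ^ 2 / p * (φsq + p * σ ^ 2) := by
        rw [hΞ, hφ]
        ring
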